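/- Let M be the 6×6 matrix over ℤ[q] with rows: row 1: (q⁴+q³−q²−q, q³−q, q⁵−2q⁴−q³+2q², q⁵−q³, q⁶−2q⁵−q⁴+2q, −2q⁴−q³+2q²+q); row 2: (q³−q, q⁴+q³−q²−q, q⁵−q³, q⁵−2q⁴−q³+2q², q⁶−2q⁵−q⁴+2q, −2q⁴−q³+2q²+q); row 3: (q³−2q², q³, q⁵+q⁴−3q³+3q², q⁵−3q³, q⁶−2q⁵−3q⁴+4q³, −2q⁴+2q³); row 4: (q³, q³−2q², q⁵−3q³, q⁵+q⁴−3q³+3q², q⁶−2q⁵−3q⁴+4q³, −2q⁴+2q³); row 5: (q³, q³, q⁵−3q³, q⁵−3q³, q⁶−2q⁵−2q⁴+4q³+q², −2q⁴); row 6: (−1, −1, 2q², 2q², −4q²+2, q⁴−2q²+2q+1). For g ≥ 0 set v^g = M^g·(1,0,0,0,0,0)ᵗ and write v^g = (ẽ₀^g, ẽ₁^g, ẽ₂^g, ẽ₃^g, ã^g, b̃^g). For g ≥ 1 let m₂^g = (q²−1)(q³−q)^{2g−2} + (1/2)(−q(q+1)(q²+q)^{2g−2} + (q−2)(q−1)(q²−q)^{2g−2})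 in ℚ[q]. Then for every g ≥ 1, the identity ẽ₂^g = q·m₂^g holds in ℚ[q]. -/

import Mathlib

open Polynomial Matrix

noncomputable section

/-- The indeterminate `q` of `ℤ[q]`. -/
def q : Polynomial ℤ := Polynomial.X

/-- The transition matrix `M` of the genus-adding handle attachment. -/
def M : Matrix (Fin 6) (Fin 6) (Polynomial ℤ) :=
  !![q^4+q^3-q^2-q, q^3-q, q^5-2*q^4-q^3+2*q^2, q^5-q^3, q^6-2*q^5-q^4+2*q, -2*q^4-q^3+2*q^2+q;
     q^3-q, q^4+q^3-q^2-q, q^5-q^3, q^5-2*q^4-q^3+2*q^2, q^6-2*q^5-q^4+2*q, -2*q^4-q^3+2*q^2+q;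
     q^3-2*q^2, q^3, q^5+q^4-3*q^3+3*q^2, q^5-3*q^3, q^6-2*q^5-3*q^4+4*q^3, -2*q^4+2*q^3;
     q^3, q^3-2*q^2, q^5-3*q^3, q^5+q^4-3*q^3+3*q^2, q^6-2*q^5-3*q^4+4*q^3, -2*q^4+2*q^3;
     q^3, q^3, q^5-3*q^3, q^5-3*q^3, q^6-2*q^5-2*q^4+4*q^3+q^2, -2*q^4;
     -1, -1, 2*q^2, 2*q^2, -4*q^2+2, q^4-2*q^2+2*q+1]

/-- `v g = M^g · (1,0,0,0,0,0)ᵗ`, whose components are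
`(ẽ₀^g, ẽ₁^g, ẽ₂^g, ẽ₃^g, ã^g, b̃^g)`. -/
def v (g : ℕ) : Fin 6 → Polynomial ℤ :=
  (M ^ g).mulVec ![1, 0, 0, 0, 0, 0]

/-- The indeterminate `q` of `ℚ[q]`. -/
def x : Polynomial ℚ := Polynomial.X

/-- `m₂^g`, the E-polynomial of the character variety `M_{J₊}^g`. -/
def m2 (g : ℕ) : Polynomial ℚ :=
  (x^2-1)*(x^3-x)^(2*g-2)
    + C (1/2 : ℚ) * (-(x*(x+1)*(x^2+x)^(2*g-2)) + (x-2)*(x-1)*(x^2-x)^(2*g-2))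

theorem v_succ (g : ℕ) : v (g + 1) = M *ᵥ v g := by
  rw [v, v, pow_succ', mulVec_mulVec]

/-- The vector `2 • v (n + 1)`, decomposed into eigenvectors of `M` for the eigenvalues
`(q³-q)²`, `(q²+q)²`, `(q²-q)²` and `(q²-1)²`. -/
def eigenSum (n : ℕ) : Fin 6 → ℤ[X] :=
  (2*q*(q^2-1) * (q^3-q)^(2*n)) • ![1, 1, 1, 1, 1, 0]
    + (q*(q+1) * (q^2+q)^(2*n)) • ![q*(q-1), 1-q, -q, 1, 1, -1]
    + (q*(1-q) * (q^2-q)^(2*n)) • ![(q+1)*(2-q), q+1, 2-q, 1, 1, 1]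
    + (2*(q^2-1) * (q^2-1)^(2*n)) • ![q, q, 0, 0, 0, 1]

theorem M_mulVec_eigenSum (n : ℕ) : M *ᵥ eigenSum n = eigenSum (n + 1) := by
  have h₁ : M *ᵥ ![1, 1, 1, 1, 1, 0] = (q^3-q)^2 • ![1, 1, 1, 1, 1, 0] := by
    ext1 i
    fin_cases i <;> simp [M, mulVec, dotProduct, Fin.sum_univ_succ] <;> ring
  have h₂ : M *ᵥ ![q*(q-1), 1-q, -q, 1, 1, -1]
      = (q^2+q)^2 • ![q*(q-1), 1-q, -q, 1, 1, -1] := by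
    ext1 i
    fin_cases i <;> simp [M, mulVec, dotProduct, Fin.sum_univ_succ] <;> ring
  have h₃ : M *ᵥ ![(q+1)*(2-q), q+1, 2-q, 1, 1, 1]
      = (q^2-q)^2 • ![(q+1)*(2-q), q+1, 2-q, 1, 1, 1] := by
    ext1 i
    fin_cases i <;> simp [M, mulVec, dotProduct, Fin.sum_univ_succ] <;> ring
  have h₄ : M *ᵥ ![q, q, 0, 0, 0, 1] = (q^2-1)^2 • ![q, q, 0, 0, 0, 1] := by
    ext1 i
    fin_cases i <;> simp [M, mulVec, dotProduct, Fin.sum_univ_succ] <;> ring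
  simp only [eigenSum, mulVec_add, mulVec_smul, h₁, h₂, h₃, h₄, smul_smul, mul_add, mul_one,
    pow_add, mul_assoc]

theorem two_smul_v_succ (n : ℕ) : (2 : ℤ[X]) • v (n + 1) = eigenSum n := by
  induction n with
  | zero =>
    ext1 i
    fin_cases i <;> simp [v, eigenSum, M] <;> ring
  | succ n ih => rw [v_succ, ← mulVec_smul, ih, M_mulVec_eigenSum]

theorem stmt_9 (g : ℕ) (hg : 1 ≤ g) :
    (v g 2).map (Int.castRingHom ℚ) = x * m2 g := by
  obtain ⟨n, rfl⟩ := Nat.exists_eq_add_of_le' hg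
  have h := congrArg (Polynomial.map (Int.castRingHom ℚ)) (congrFun (two_smul_v_succ n) 2)
  have hq : q.map (Int.castRingHom ℚ) = x := Polynomial.map_X _
  simp only [eigenSum, Pi.add_apply, Pi.smul_apply, smul_eq_mul, cons_val, Polynomial.map_add,
    Polynomial.map_mul, Polynomial.map_sub, Polynomial.map_neg, Polynomial.map_pow,
    Polynomial.map_one, Polynomial.map_zero, Polynomial.map_ofNat, hq] at h
  have hC : (2 : ℚ[X]) * C (1/2 : ℚ) = 1 := by
    rw [← C_ofNat, ← C_mul]
    norm_num
  refine mul_left_cancel₀ (two_ne_zero : (2 : ℚ[X]) ≠ 0) (h.trans ?_)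
  rw [m2, show 2 * (n + 1) - 2 = 2 * n by omega]
  linear_combination (-x * (-(x*(x+1)*(x^2+x)^(2*n)) + (x-2)*(x-1)*(x^2-x)^(2*n))) * hC
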